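/- For a simple oriented matroid M with tope set T, κ*_3(M) = ((|T|-2)/2)·κ°*_1(M) + κ°*_3(M). -/

import Mathlib

open scoped Classical

/-- Negation of a sign vector (tope), `+` ↔ `true`, `-` ↔ `false`. -/
def negT {E : Type*} (f : E → Bool) : E → Bool := fun e => !(f e)

/-- `K` is a tope committee for the (simple) oriented matroid with tope set `T`:
`K ⊆ T` and for every ground element `e`, strictly more than half of the members
of `K` have sign `+` at `e`. -/
def IsCommittee {E : Type*} (T K : Finset (E → Bool)) : Prop :=
  K ⊆ T ∧ ∀ e : E, K.card < 2 * (K.filter (fun f => f e = true)).card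

/-- `κ*_k`: the number of tope committees of cardinality `k`. -/
noncomputable def kappa {E : Type*} (T : Finset (E → Bool)) (k : ℕ) : ℕ :=
  (T.powerset.filter (fun K => K.card = k ∧ IsCommittee T K)).card

/-- `κ°*_k`: the number of tope committees of cardinality `k` containing no pair
of opposite topes. -/
noncomputable def kappaFree {E : Type*} (T : Finset (E → Bool)) (k : ℕ) : ℕ :=
  (T.powerset.filter
    (fun K => K.card = k ∧ IsCommittee T K ∧ ∀ f ∈ K, negT f ∉ K)).card


lemma negT_negT {E : Type*} (f : E → Bool) : negT (negT f) = f := by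
  funext e; simp [negT]

lemma negT_ne {E : Type*} [Nonempty E] (f : E → Bool) : negT f ≠ f := by
  intro h
  have := congrFun h (Classical.arbitrary E)
  simp [negT] at this

/-- the positive tope -/
def posT (E : Type*) : E → Bool := fun _ => true

lemma three_card {E : Type*} [Nonempty E] (f g : E → Bool) (h1 : f ≠ g) (h2 : negT f ≠ g) :
    ({f, negT f, g} : Finset (E → Bool)).card = 3 := by
  rw [Finset.card_eq_three]
  exact ⟨f, negT f, g, (negT_ne f).symm, h1, h2, rfl⟩

lemma three_filter {E : Type*} [Nonempty E] (f g : E → Bool) (h1 : f ≠ g) (h2 : negT f ≠ g)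
    (e : E) :
    3 < 2 * (({f, negT f, g} : Finset (E → Bool)).filter (fun f => f e = true)).card
      ↔ g e = true := by
  have h3 := negT_ne f
  have h4 : (({f, negT f, g} : Finset (E → Bool)).filter (fun f => f e = true)).card =
      (if f e = true then 1 else 0) + ((if negT f e = true then 1 else 0) +
        (if g e = true then 1 else 0)) := by
    rw [Finset.card_filter, Finset.sum_insert (by simp [h3.symm, h1]),
      Finset.sum_insert (by simp [h2]), Finset.sum_singleton]
  rw [h4]
  have : negT f e = !(f e) := rfl
  rw [this]
  cases f e <;> cases g e <;> simp

lemma bad_form {E : Type*} [Nonempty E] (T K : Finset (E → Bool)) (h3 : K.card = 3)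
    (hK : IsCommittee T K) (f : E → Bool) (hf : f ∈ K) (hn : negT f ∈ K) :
    f ≠ posT E ∧ negT f ≠ posT E ∧ K = {f, negT f, posT E} := by
  have hsub : ({f, negT f} : Finset (E → Bool)) ⊆ K := by
    intro x hx
    simp only [Finset.mem_insert, Finset.mem_singleton] at hx
    rcases hx with rfl | rfl <;> assumption
  have hc : ({f, negT f} : Finset (E → Bool)).card = 2 := Finset.card_pair (negT_ne f).symm
  obtain ⟨g, hg, hg'⟩ := Finset.exists_mem_notMem_of_card_lt_card
    (s := ({f, negT f} : Finset (E → Bool))) (t := K) (by omega)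
  simp only [Finset.mem_insert, Finset.mem_singleton, not_or] at hg'
  have h1 : f ≠ g := fun h => hg'.1 h.symm
  have h2 : negT f ≠ g := fun h => hg'.2 h.symm
  have hKe : ({f, negT f, g} : Finset (E → Bool)) = K := by
    apply Finset.eq_of_subset_of_card_le
    · intro x hx
      simp only [Finset.mem_insert, Finset.mem_singleton] at hx
      rcases hx with rfl | rfl | rfl <;> assumption
    · rw [three_card f g h1 h2, h3]
  have hgp : g = posT E := by
    funext e
    have := hK.2 e
    rw [h3, ← hKe] at this
    exact (three_filter f g h1 h2 e).1 this
  subst hgp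
  exact ⟨h1, h2, hKe.symm⟩

lemma kappaFree_one {E : Type*} [Nonempty E] (T : Finset (E → Bool)) :
    kappaFree T 1 = if posT E ∈ T then 1 else 0 := by
  have key : T.powerset.filter
      (fun K => K.card = 1 ∧ IsCommittee T K ∧ ∀ f ∈ K, negT f ∉ K) =
      if posT E ∈ T then {{posT E}} else ∅ := by
    ext K
    simp only [Finset.mem_filter, Finset.mem_powerset]
    constructor
    · rintro ⟨hs, hc, hK, -⟩
      obtain ⟨g, rfl⟩ := Finset.card_eq_one.1 hc
      have : g = posT E := by
        funext e
        have := hK.2 e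
        by_contra hne
        rw [Finset.filter_singleton] at this
        have h' : ¬ g e = true := hne
        rw [if_neg h'] at this
        simp at this
      subst this
      have hT : posT E ∈ T := hs (Finset.mem_singleton_self _)
      simp [hT]
    · intro h
      split_ifs at h with hT
      · rw [Finset.mem_singleton] at h
        subst h
        have hs : ({posT E} : Finset (E → Bool)) ⊆ T := by simpa using hT
        refine ⟨hs, by simp, ⟨hs, fun e => ?_⟩, ?_⟩
        · rw [Finset.filter_singleton]; simp [posT]
        · intro f hf
          rw [Finset.mem_singleton] at hf ⊢
          subst hf
          exact negT_ne _
      · simp at h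
  unfold kappaFree
  rw [key]
  split_ifs <;> simp

lemma half_card {E : Type*} (T : Finset (E → Bool))
    (hneg : ∀ f ∈ T, negT f ∈ T) (e : E) :
    T.card = 2 * (T.filter (fun f => f e = true)).card := by
  have h1 := Finset.card_filter_add_card_filter_not (s := T) (fun f => f e = true)
  have h2 : (T.filter (fun f => f e = true)).card = (T.filter (fun f => ¬ f e = true)).card := by
    apply Finset.card_bij' (fun f _ => negT f) (fun f _ => negT f)
    · intro f hf
      simp only [Finset.mem_filter] at hf ⊢
      exact ⟨hneg f hf.1, by simp [negT, hf.2]⟩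
    · intro f hf
      simp only [Finset.mem_filter] at hf ⊢
      exact ⟨hneg f hf.1, by simpa [negT] using hf.2⟩
    · intro f _; exact negT_negT f
    · intro f _; exact negT_negT f
  omega

lemma bad_card {E : Type*} [Nonempty E] (T : Finset (E → Bool))
    (hneg : ∀ f ∈ T, negT f ∈ T) :
    (T.powerset.filter
      (fun K => (K.card = 3 ∧ IsCommittee T K) ∧ ¬ ∀ f ∈ K, negT f ∉ K)).card =
      ((T.card - 2) / 2) * if posT E ∈ T then 1 else 0 := by
  split_ifs with hT
  · let e : E := Classical.arbitrary E
    have hS : (((T.filter (fun f => f e = true)).erase (posT E))).card = (T.card - 2) / 2 := by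
      rw [Finset.card_erase_of_mem (by simp [hT, posT]), half_card T hneg e]
      omega
    rw [mul_one, ← hS]
    symm
    apply Finset.card_bij (fun f _ => ({f, negT f, posT E} : Finset (E → Bool)))
    · intro f hf
      simp only [Finset.mem_erase, Finset.mem_filter] at hf
      obtain ⟨h1, hfT, hfe⟩ := hf
      have h2 : negT f ≠ posT E := by
        intro h
        have := congrFun h e
        simp [negT, posT, hfe] at this
      have hs : ({f, negT f, posT E} : Finset (E → Bool)) ⊆ T := by
        intro x hx
        simp only [Finset.mem_insert, Finset.mem_singleton] at hx
        rcases hx with rfl | rfl | rfl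
        exacts [hfT, hneg _ hfT, hT]
      have hc := three_card f _ h1 h2
      rw [Finset.mem_filter, Finset.mem_powerset]
      refine ⟨hs, ⟨hc, hs, fun e' => ?_⟩, fun h => h f (by simp) (by simp)⟩
      rw [hc]
      exact (three_filter f _ h1 h2 e').2 rfl
    · intro f hf g hg h
      simp only [Finset.mem_erase, Finset.mem_filter] at hf hg
      have hm : f ∈ ({g, negT g, posT E} : Finset (E → Bool)) := by
        rw [← h]; simp
      simp only [Finset.mem_insert, Finset.mem_singleton] at hm
      rcases hm with h' | h' | h'
      · exact h'
      · have := hf.2.2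
        rw [h'] at this
        simp [negT, hg.2.2] at this
      · exact absurd h' hf.1
    · intro K hK
      rw [Finset.mem_filter, Finset.mem_powerset] at hK
      obtain ⟨hs, ⟨hc, hK⟩, hb⟩ := hK
      push Not at hb
      obtain ⟨f, hf, hn⟩ := hb
      obtain ⟨h1, h2, h3⟩ := bad_form T K hc hK f hf hn
      by_cases hfe : f e = true
      · exact ⟨f, by simp [h1, hs hf, hfe], h3.symm⟩
      · refine ⟨negT f, ?_, ?_⟩
        · simp only [Finset.mem_erase, Finset.mem_filter]
          exact ⟨h2, hs hn, by simpa [negT] using hfe⟩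
        · rw [negT_negT, h3, Finset.insert_comm]
  · rw [mul_zero, Finset.card_eq_zero, Finset.filter_eq_empty_iff]
    rintro K hKs ⟨⟨hc, hK⟩, hb⟩
    push Not at hb
    obtain ⟨f, hf, hn⟩ := hb
    obtain ⟨h1, h2, h3⟩ := bad_form T K hc hK f hf hn
    apply hT
    apply hK.1
    rw [h3]; simp

theorem stmt9 {E : Type*} [Fintype E] [Nonempty E] (T : Finset (E → Bool))
    (hneg : ∀ f ∈ T, negT f ∈ T) :
    kappa T 3 = ((T.card - 2) / 2) * kappaFree T 1 + kappaFree T 3 := by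
  rw [kappaFree_one, ← bad_card T hneg]
  unfold kappa kappaFree
  rw [← Finset.card_filter_add_card_filter_not
    (s := T.powerset.filter (fun K => K.card = 3 ∧ IsCommittee T K))
    (fun K => ∀ f ∈ K, negT f ∉ K), Finset.filter_filter, Finset.filter_filter, add_comm]
  simp only [and_assoc]
  congr!
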